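/- arXiv:2204.04057 — 2 statements merged into one kernel-verified Lean document; each statement's English description precedes it below -/
import Mathlib

section
/- For any constant α > 0 and all sufficiently large n, consider a round t of the Packing process whose normalized load configuration is y^t = (√n, 0, …, 0, −1, …, −1), with one bin of normalized load √n, n − √n − 1 bins of normalized load 0, and √n bins of normalized load −1. Then the potential Ψ^t := Σ_{i : y_i^t ≥ 0} exp(α·y_i^t) increases in expectation over one round: E[Ψ^{t+1} | F^t] ≥ Ψ^t·(1 + 0.1·α²/n). -/
open MeasureTheory ProbabilityTheory Real Finset
open scoped ENNReal Classical

noncomputable section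

/-- An allocation process on `n` bins: a probability space with a filtration,
load vectors `x t`, and a sampled bin `sel t` in each round. -/
structure AllocProc (n : ℕ) where
  Ω : Type
  m0 : MeasurableSpace Ω
  μ : Measure Ω
  prob : IsProbabilityMeasure μ
  F : Filtration ℕ m0
  x : ℕ → Ω → Fin n → ℕ
  sel : ℕ → Ω → Fin n
  x_zero : ∀ ω i, x 0 ω i = 0
  meas_x : ∀ t i, Measurable[F t] fun ω => x t ω i
  meas_sel : ∀ t, Measurable[F (t + 1)] (sel t)

namespace AllocProc

variable {n : ℕ} (P : AllocProc n)

/-- Total number of balls allocated after `t` rounds. -/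
def W (t : ℕ) (ω : P.Ω) : ℕ := ∑ i, P.x t ω i

/-- Normalized load of bin `i` after `t` rounds. -/
def y (t : ℕ) (ω : P.Ω) (i : Fin n) : ℝ := (P.x t ω i : ℝ) - (P.W t ω : ℝ) / n

/-- The gap between maximum and average load after `t` rounds. -/
def Gap (t : ℕ) (ω : P.Ω) : ℝ := (⨆ i, (P.x t ω i : ℝ)) - (P.W t ω : ℝ) / n

/-- The absolute value potential `Δ^t`. -/
def Δpot (t : ℕ) (ω : P.Ω) : ℝ := ∑ i, |P.y t ω i|

/-- Condition `𝒫`: in each round the sampled bin is chosen according to a probability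
vector (conditional on the past) which, indexed by decreasing load, is majorized by the
uniform distribution. -/
def CondP : Prop :=
  ∃ σ : ℕ → P.Ω → Equiv.Perm (Fin n),
    (∀ t ω, Antitone fun k => P.y t ω (σ t ω k)) ∧
    (∀ (t k : ℕ),
      ∀ᵐ ω ∂P.μ,
        (P.μ[({ω' | ((σ t ω').symm (P.sel t ω') : ℕ) < k} : Set P.Ω).indicator
            (fun _ => (1 : ℝ)) | P.F t]) ω ≤ (k : ℝ) / n)

/-- Condition `𝒲`: if the sampled bin is overloaded it gets one ball; otherwise exactly
`⌈-y⌉ + 1` balls are placed into underloaded bins, with at most one bin receiving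
`⌈-y⌉ + 1` balls, at most one receiving `⌈-y⌉` balls, and all others at most `⌈-y⌉ - 1`. -/
def CondW : Prop :=
  ∀ t ω,
    (0 ≤ P.y t ω (P.sel t ω) →
      ∀ j, P.x (t + 1) ω j = P.x t ω j + if j = P.sel t ω then 1 else 0) ∧
    (P.y t ω (P.sel t ω) < 0 →
      (∀ j, P.x t ω j ≤ P.x (t + 1) ω j) ∧
      (∀ j, 0 ≤ P.y t ω j → P.x (t + 1) ω j = P.x t ω j) ∧
      (P.W (t + 1) ω = P.W t ω + ⌈-(P.y t ω (P.sel t ω))⌉₊ + 1) ∧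
      (∃ k1 k2 : Fin n, P.y t ω k1 < 0 ∧ P.y t ω k2 < 0 ∧
        ((P.x (t + 1) ω k1 : ℤ) ≤ (P.x t ω k1 : ℤ) + ⌈-(P.y t ω k1)⌉ + 1) ∧
        ((P.x (t + 1) ω k2 : ℤ) ≤ (P.x t ω k2 : ℤ) + ⌈-(P.y t ω k2)⌉) ∧
        (∀ j, P.y t ω j < 0 → j ≠ k1 → j ≠ k2 →
          (P.x (t + 1) ω j : ℤ) ≤ (P.x t ω j : ℤ) + ⌈-(P.y t ω j)⌉ - 1)))

/-- The bin sampled in each round is uniform, conditionally on the past. -/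
def UniformSampling : Prop :=
  ∀ (t : ℕ) (i : Fin n),
    ∀ᵐ ω ∂P.μ,
      (P.μ[({ω' | P.sel t ω' = i} : Set P.Ω).indicator (fun _ => (1 : ℝ)) | P.F t]) ω
        = 1 / n

/-- The allocation rule of the `Packing` process: one ball into the sampled bin if it is
overloaded; otherwise the sampled bin is filled up to load `⌈W^t/n⌉ + 1`. -/
def PackingRule : Prop :=
  ∀ t ω j,
    P.x (t + 1) ω j =
      if j = P.sel t ω then
        if (P.W t ω : ℝ) / n ≤ (P.x t ω j : ℝ) then P.x t ω j + 1
        else ⌈(P.W t ω : ℝ) / n⌉₊ + 1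
      else P.x t ω j

/-- The `Packing` process: uniform sampling together with the packing allocation rule. -/
def IsPacking : Prop := P.UniformSampling ∧ P.PackingRule

/-- The exponential potential `Φ^t(α)`, over bins overloaded by at least two balls. -/
def Φ (α : ℝ) (t : ℕ) (ω : P.Ω) : ℝ :=
  ∑ i, if 2 ≤ P.y t ω i then Real.exp (α * P.y t ω i) else 0

end AllocProc

namespace AllocProc

variable {n : ℕ} (P : AllocProc n)

/-- The "good event" `𝒢^t`: at least `n/20` underloaded bins, or `Δ^t ≥ n/10`. -/
def Gev (t : ℕ) : Set P.Ω :=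
  {ω | (n : ℝ) / 20 ≤ ((Finset.univ.filter fun i => P.y t ω i < 0).card : ℝ) ∨
       (n : ℝ) / 10 ≤ P.Δpot t ω}

/-- `G_{t0}^s`: number of rounds `r ∈ [t0, s)` in which the good event `𝒢^r` holds. -/
def GCount (t0 s : ℕ) (ω : P.Ω) : ℕ :=
  ((Finset.Ico t0 s).filter fun r => ω ∈ P.Gev r).card

/-- The adjusted potential `Φ̃^s` (relative to a starting round `t0`). -/
def tildePhi (α c1 c2 c3 : ℝ) (t0 s : ℕ) (ω : P.Ω) : ℝ :=
  P.Φ α s ω * Real.exp (c2 * α / n * (P.GCount t0 (s - 1) ω : ℝ)) *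
      Real.exp (-(c1 * α ^ 2 / n) * (((s - 1 - t0) - P.GCount t0 (s - 1) ω : ℕ) : ℝ)) -
    c3 * ((s - t0 : ℕ) : ℝ)

/-- An `(a,b)`-biased sampling vector: conditionally on the past, each bin is sampled with
probability between `1/(a n)` and `b/n`. -/
def BiasedSampling (a b : ℝ) : Prop :=
  ∀ (t : ℕ) (i : Fin n),
    ∀ᵐ ω ∂P.μ,
      1 / (a * n) ≤
          (P.μ[({ω' | P.sel t ω' = i} : Set P.Ω).indicator (fun _ => (1 : ℝ)) | P.F t]) ω ∧
        (P.μ[({ω' | P.sel t ω' = i} : Set P.Ω).indicator (fun _ => (1 : ℝ)) | P.F t]) ω ≤ b / n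

/-- The exponential potential over all non-underloaded bins. -/
def Ψ (α : ℝ) (t : ℕ) (ω : P.Ω) : ℝ :=
  ∑ i, if 0 ≤ P.y t ω i then Real.exp (α * P.y t ω i) else 0

/-- An unfolding of the process `P`: one ball is allocated per atomic allocation, balls are
never removed, and after `W^t` atomic allocations the load vector agrees with `x^t`. -/
def IsUnfolding (u : ℕ → P.Ω → Fin n → ℕ) : Prop :=
  (∀ ω i, u 0 ω i = 0) ∧
  (∀ s ω, (∀ i, u s ω i ≤ u (s + 1) ω i) ∧ (∑ i, u (s + 1) ω i) = (∑ i, u s ω i) + 1) ∧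
  (∀ t ω, u (P.W t ω) ω = P.x t ω)

/-- The gap of an unfolding after `s` atomic allocations. -/
def GapU (u : ℕ → P.Ω → Fin n → ℕ) (s : ℕ) (ω : P.Ω) : ℝ :=
  (⨆ i, (u s ω i : ℝ)) - (s : ℝ) / n

end AllocProc

/-- The two growth estimates behind the claim, as the square root `s` of the number of bins
tends to infinity. -/
lemma eventually_growth_bounds {α : ℝ} (hα : 0 < α) :
    ∀ᶠ s : ℝ in Filter.atTop, 2 ≤ s ∧ α ^ 2 + α ^ 3 / 2 + α * s ≤ 0.2 * α ^ 2 * s ^ 2 ∧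
      s ^ 2 * (s ^ 2 + 0.1 * α ^ 2) ≤ 0.2 * α ^ 2 * Real.exp (α * s) := by
  have h4 := (isLittleO_pow_exp_pos_mul_atTop 4 hα).bound
    (show (0 : ℝ) < 0.1 * α ^ 2 by positivity)
  have h2 := (isLittleO_pow_exp_pos_mul_atTop 2 hα).bound (show (0 : ℝ) < 1 by norm_num)
  filter_upwards [h4, h2, Filter.eventually_ge_atTop (2 : ℝ),
    Filter.eventually_ge_atTop ((α ^ 2 + α ^ 3 / 2 + α) / (0.2 * α ^ 2))] with s h4 h2 hs hs'
  rw [div_le_iff₀ (by positivity)] at hs'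
  simp only [norm_pow, Real.norm_eq_abs, abs_of_pos (Real.exp_pos _),
    abs_of_nonneg (show (0 : ℝ) ≤ s by linarith)] at h4 h2
  refine ⟨hs, ?_, ?_⟩
  · have h1 : (α ^ 2 + α ^ 3 / 2) * 1 ≤ (α ^ 2 + α ^ 3 / 2) * s := by gcongr; linarith
    have h3 := mul_le_mul_of_nonneg_right hs' (show (0 : ℝ) ≤ s by linarith)
    nlinarith
  · have := mul_le_mul_of_nonneg_left h2 (show (0 : ℝ) ≤ 0.1 * α ^ 2 by positivity)
    nlinarith

/-- The one-round drift inequality for the configuration `(√n, 0, …, 0, -1, …, -1)`,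
with `n = s ^ 2`. -/
lemma drift_inequality {α s n : ℝ} (hα : 0 < α) (hn : n = s ^ 2) (hs : 2 ≤ s)
    (h1 : α ^ 2 + α ^ 3 / 2 + α * s ≤ 0.2 * α ^ 2 * s ^ 2)
    (h2 : s ^ 2 * (s ^ 2 + 0.1 * α ^ 2) ≤ 0.2 * α ^ 2 * Real.exp (α * s)) :
    (Real.exp (α * s) + (n - s - 1)) * (1 + 0.1 * α ^ 2 / n) ≤
      (Real.exp (α * (s + 1 - 1 / n)) + (n - s - 1) * Real.exp (α * (s - 1 / n)) +
        s * Real.exp (α * (s - 2 / n))) * (1 / n) := by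
  have hn0 : 0 < n := by rw [hn]; positivity
  have hsn : s + 1 ≤ n := by nlinarith
  rw [← hn] at h1 h2
  have e1 : Real.exp (α * (s + 1 - 1 / n)) =
      Real.exp (α * s) * (Real.exp α * Real.exp (-(α / n))) := by
    rw [← Real.exp_add, ← Real.exp_add]; ring_nf
  have e2 : Real.exp (α * (s - 1 / n)) = Real.exp (α * s) * Real.exp (-(α / n)) := by
    rw [← Real.exp_add]; ring_nf
  have e3 : Real.exp (α * (s - 2 / n)) = Real.exp (α * s) * Real.exp (-(2 * (α / n))) := by
    rw [← Real.exp_add]; ring_nf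
  rw [e1, e2, e3]
  set E := Real.exp (α * s) with hE
  have hE0 : 0 < E := Real.exp_pos _
  set d := α / n with hd
  have hdn : d * n = α := by rw [hd]; field_simp
  have hd0 : 0 < d := by positivity
  have b0 : 1 + α + α ^ 2 / 2 ≤ Real.exp α := Real.quadratic_le_exp_of_nonneg hα.le
  have b1 : 1 - d ≤ Real.exp (-d) := by linarith [Real.add_one_le_exp (-d)]
  have b2 : 1 - 2 * d ≤ Real.exp (-(2 * d)) := by linarith [Real.add_one_le_exp (-(2 * d))]
  have c1 : (1 + α + α ^ 2 / 2) * (1 - d) ≤ Real.exp α * Real.exp (-d) :=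
    calc _ ≤ (1 + α + α ^ 2 / 2) * Real.exp (-d) := by gcongr
      _ ≤ _ := by gcongr
  have c2 : (n - s - 1) * (1 - d) ≤ (n - s - 1) * Real.exp (-d) :=
    mul_le_mul_of_nonneg_left b1 (by linarith)
  have c3 : s * (1 - 2 * d) ≤ s * Real.exp (-(2 * d)) :=
    mul_le_mul_of_nonneg_left b2 (by linarith)
  have h1' : d * (α + α ^ 2 / 2 + s) ≤ 0.2 * α ^ 2 := by
    rw [hd, div_mul_eq_mul_div, div_le_iff₀ hn0]; linarith
  have key : n + 0.3 * α ^ 2 ≤ Real.exp α * Real.exp (-d) + (n - s - 1) * Real.exp (-d) +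
      s * Real.exp (-(2 * d)) := by
    nlinarith
  have key' := mul_le_mul_of_nonneg_left key hE0.le
  have lhs : (E + (n - s - 1)) * (1 + 0.1 * α ^ 2 / n) =
      (E + (n - s - 1)) * (n + 0.1 * α ^ 2) * (1 / n) := by
    field_simp
  rw [lhs]
  refine mul_le_mul_of_nonneg_right ?_ (by positivity)
  have h3 : (n - s - 1) * (n + 0.1 * α ^ 2) ≤ n * (n + 0.1 * α ^ 2) := by
    gcongr; linarith
  nlinarith

/-- A sum of a function of `f i` that vanishes off three distinct values. -/
lemma sum_three_values {ι : Type*} [Fintype ι] (f : ι → ℝ) {p q r : ℝ}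
    (hpq : p ≠ q) (hpr : p ≠ r) (hqr : q ≠ r) (a b c : ℝ) :
    ∑ i, (if f i = p then a else if f i = q then b else if f i = r then c else 0) =
      ((univ.filter fun i => f i = p).card : ℝ) * a +
      ((univ.filter fun i => f i = q).card : ℝ) * b +
      ((univ.filter fun i => f i = r).card : ℝ) * c := by
  simp only [← nsmul_eq_mul, ← Finset.sum_const, Finset.sum_filter]
  rw [← Finset.sum_add_distrib, ← Finset.sum_add_distrib]
  refine Finset.sum_congr rfl fun i _ => ?_
  by_cases h1 : f i = p
  · simp [h1, hpq, hpr]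
  · by_cases h2 : f i = q
    · simp [h2, hpq.symm, hqr]
    · simp [h1, h2]

namespace AllocProc

variable {n : ℕ} {P : AllocProc n}

lemma Ψ_nonneg (α : ℝ) (t : ℕ) (ω : P.Ω) : 0 ≤ P.Ψ α t ω :=
  Finset.sum_nonneg fun _ _ => by split_ifs <;> positivity

lemma exp_le_Ψ (α : ℝ) {t : ℕ} {ω : P.Ω} {k : Fin n} (hk : 0 ≤ P.y t ω k) :
    Real.exp (α * P.y t ω k) ≤ P.Ψ α t ω := by
  have := Finset.single_le_sum (s := univ)
    (f := fun i => if 0 ≤ P.y t ω i then Real.exp (α * P.y t ω i) else 0)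
    (fun i _ => by split_ifs <;> positivity) (Finset.mem_univ k)
  simpa [hk, Ψ] using this

lemma measurable_y (t : ℕ) (i : Fin n) : Measurable[P.F t] fun ω => P.y t ω i := by
  have hc : ∀ j, Measurable[P.F t] fun ω => (P.x t ω j : ℝ) := fun j =>
    measurable_from_nat.comp (P.meas_x t j)
  have hW : Measurable[P.F t] fun ω => (P.W t ω : ℝ) := by
    simp only [W, Nat.cast_sum]
    exact Finset.measurable_fun_sum _ fun j _ => hc j
  exact (hc i).sub (hW.div_const _)

lemma measurable_Ψ (α : ℝ) (t : ℕ) : Measurable[P.F t] (P.Ψ α t) := by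
  refine Finset.measurable_fun_sum _ fun i _ => ?_
  refine Measurable.ite ?_ ?_ measurable_const
  · exact measurableSet_le measurable_const (measurable_y t i)
  · exact Real.measurable_exp.comp ((measurable_y t i).const_mul α)

/-- After a fixed number of rounds the loads of the Packing process are bounded. -/
lemma PackingRule.exists_x_le (h : P.PackingRule) (t : ℕ) :
    ∃ B : ℕ, ∀ ω i, P.x t ω i ≤ B := by
  induction t with
  | zero => exact ⟨0, fun ω i => (P.x_zero ω i).le⟩
  | succ t ih =>
    obtain ⟨B, hB⟩ := ih
    refine ⟨B + 1, fun ω i => ?_⟩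
    have hW : (P.W t ω : ℝ) / n ≤ B := by
      have : P.W t ω ≤ n * B := by
        simpa [W] using Finset.sum_le_card_nsmul univ (P.x t ω) B fun i _ => hB ω i
      have hn : (0 : ℝ) < n := by exact_mod_cast i.pos
      rw [div_le_iff₀ hn, mul_comm]
      exact_mod_cast this
    have hB' := hB ω i
    have hc : ⌈(P.W t ω : ℝ) / n⌉₊ ≤ B := Nat.ceil_le.2 hW
    rw [h t ω i]
    split_ifs <;> omega

lemma PackingRule.integrable_Ψ (h : P.PackingRule) {α : ℝ} (hα : 0 ≤ α) (t : ℕ) :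
    @Integrable _ _ _ _ P.m0 (P.Ψ α t) P.μ := by
  let := P.m0
  have := P.prob
  obtain ⟨B, hB⟩ := h.exists_x_le t
  refine Integrable.of_bound (C := n * Real.exp (α * B))
    ((measurable_Ψ α t).mono (P.F.le t) le_rfl).aestronglyMeasurable
    (Filter.Eventually.of_forall fun ω => ?_)
  rw [Real.norm_of_nonneg (Ψ_nonneg α t ω), Ψ]
  have : ∀ i ∈ (univ : Finset (Fin n)),
      (if 0 ≤ P.y t ω i then Real.exp (α * P.y t ω i) else 0) ≤ Real.exp (α * B) := by
    intro i _
    split_ifs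
    · have hx : (P.x t ω i : ℝ) ≤ B := by exact_mod_cast hB ω i
      have hy : P.y t ω i ≤ B := by
        have : (0 : ℝ) ≤ (P.W t ω : ℝ) / n := by positivity
        simp only [y]; linarith
      gcongr
    · positivity
  simpa using Finset.sum_le_card_nsmul univ _ _ this

/-- The effect on the normalized loads of placing `d` balls into the sampled bin. -/
lemma y_succ_of_x_succ {t : ℕ} {ω : P.Ω} {i : Fin n} {d : ℕ}
    (hx : ∀ j, P.x (t + 1) ω j = P.x t ω j + if j = i then d else 0) (j : Fin n) :
    P.y (t + 1) ω j = P.y t ω j + (if j = i then (d : ℝ) else 0) - d / n := by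
  have hW : P.W (t + 1) ω = P.W t ω + d := by
    simp [W, hx, Finset.sum_add_distrib]
  simp only [y, hW, hx]
  split_ifs <;> push_cast <;> ring

lemma PackingRule.x_succ_of_nonneg (h : P.PackingRule) {t : ℕ} {ω : P.Ω}
    (hy : 0 ≤ P.y t ω (P.sel t ω)) (j : Fin n) :
    P.x (t + 1) ω j = P.x t ω j + if j = P.sel t ω then 1 else 0 := by
  rw [h t ω j]
  split_ifs with h1 h2
  · rfl
  · subst h1
    exact absurd (sub_nonneg.1 hy) h2
  · rfl

lemma PackingRule.x_succ_of_eq_neg_one (h : P.PackingRule) {t : ℕ} {ω : P.Ω}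
    (hy : P.y t ω (P.sel t ω) = -1) (j : Fin n) :
    P.x (t + 1) ω j = P.x t ω j + if j = P.sel t ω then 2 else 0 := by
  rw [h t ω j]
  split_ifs with h1 h2
  · subst h1
    simp only [y] at hy
    linarith
  · subst h1
    have : (P.W t ω : ℝ) / n = ((P.x t ω (P.sel t ω) + 1 : ℕ) : ℝ) := by
      simp only [y] at hy
      push_cast
      linarith
    rw [this, Nat.ceil_natCast]
  · rfl

/-- A lower bound for the potential after one round, if bin `k` has normalized load `s ≥ 1`,
according to the normalized load of the sampled bin. -/
lemma PackingRule.le_Ψ_succ (h : P.PackingRule) (α : ℝ) {t : ℕ} {ω : P.Ω} {s : ℝ}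
    (hs : 1 ≤ s) (hn : 2 ≤ n) {k : Fin n} (hk : P.y t ω k = s) :
    (if P.y t ω (P.sel t ω) = s then Real.exp (α * (s + 1 - 1 / n))
      else if P.y t ω (P.sel t ω) = 0 then Real.exp (α * (s - 1 / n))
      else if P.y t ω (P.sel t ω) = -1 then Real.exp (α * (s - 2 / n)) else 0) ≤
      P.Ψ α (t + 1) ω := by
  have hn' : (2 : ℝ) ≤ n := by exact_mod_cast hn
  have h2 : 2 / (n : ℝ) ≤ 1 := by rw [div_le_one (by linarith)]; exact hn'
  have h1 : 1 / (n : ℝ) ≤ 1 := by rw [div_le_one (by linarith)]; linarith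
  split_ifs with c1 c2 c3
  · have e := y_succ_of_x_succ (h.x_succ_of_nonneg (by linarith)) (P.sel t ω)
    simp only [if_true, c1, Nat.cast_one] at e
    rw [← e]
    exact exp_le_Ψ α (by linarith)
  · have e := y_succ_of_x_succ (h.x_succ_of_nonneg c2.ge) k
    have hne : k ≠ P.sel t ω := by rintro rfl; exact c1 hk
    simp only [if_neg hne, hk, Nat.cast_one, add_zero] at e
    rw [← e]
    exact exp_le_Ψ α (by linarith)
  · have e := y_succ_of_x_succ (h.x_succ_of_eq_neg_one c3) k
    have hne : k ≠ P.sel t ω := by rintro rfl; exact c1 hk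
    simp only [if_neg hne, hk, Nat.cast_ofNat, add_zero] at e
    rw [← e]
    exact exp_le_Ψ α (by linarith)
  · exact Ψ_nonneg _ _ _

/-- Averaging over a uniformly sampled bin: if `Z` dominates `g (sel t)` with each `g i`
bounded and known at time `t`, then its conditional expectation dominates the mean of `g`. -/
lemma UniformSampling.sum_div_le_condExp (h : P.UniformSampling) (t : ℕ)
    {g : Fin n → P.Ω → ℝ} (hg : ∀ i, Measurable[P.F t] (g i)) {C : ℝ}
    (hC : ∀ i ω, |g i ω| ≤ C) {Z : P.Ω → ℝ} (hZ : @Integrable _ _ _ _ P.m0 Z P.μ)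
    (hgZ : ∀ ω, g (P.sel t ω) ω ≤ Z ω) :
    ∀ᵐ ω ∂P.μ, (∑ i, g i ω) * (1 / n) ≤ (P.μ[Z | P.F t]) ω := by
  let := P.m0
  have := P.prob
  set I : Fin n → P.Ω → ℝ := fun i =>
    ({ω' | P.sel t ω' = i} : Set P.Ω).indicator (fun _ => (1 : ℝ)) with hI
  have hIm : ∀ i, Integrable (I i) P.μ := fun i =>
    (integrable_const (1 : ℝ)).indicator
      ((P.meas_sel t).mono (P.F.le _) le_rfl (measurableSet_singleton i))
  have hgI : ∀ i, Integrable (g i * I i) P.μ := fun i =>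
    (hIm i).bdd_mul (c := C) ((hg i).mono (P.F.le t) le_rfl).aestronglyMeasurable
      (Filter.Eventually.of_forall fun ω => hC i ω)
  have hle : (∑ i, g i * I i) ≤ᵐ[P.μ] Z := Filter.Eventually.of_forall fun ω => by
    have : (∑ i, g i * I i) ω = g (P.sel t ω) ω := by
      simp [hI, Set.indicator_apply]
    rw [this]
    exact hgZ ω
  have hmono := condExp_mono (m := P.F t) (integrable_finsetSum' _ fun i _ => hgI i) hZ hle
  have hsum := condExp_finsetSum (s := univ) (fun i _ => hgI i) (P.F t)
  have hpull : ∀ i, P.μ[g i * I i | P.F t] =ᵐ[P.μ] g i * P.μ[I i | P.F t] := fun i =>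
    condExp_mul_of_stronglyMeasurable_left (hg i).stronglyMeasurable (hgI i) (hIm i)
  filter_upwards [hmono, hsum, ae_all_iff.2 hpull, ae_all_iff.2 (h t)] with ω h1 h2 h3 h4
  rw [h2, Finset.sum_apply] at h1
  refine le_of_eq_of_le ?_ h1
  rw [Finset.sum_mul]
  refine Finset.sum_congr rfl fun i _ => ?_
  rw [h3 i, Pi.mul_apply, h4 i]

end AllocProc

/-- **Claim B.1 (counterexample).** For any constant `α > 0` and sufficiently large `n`,
consider a round `t` of the `Packing` process whose normalized load configuration is
`y^t = (√n, 0, …, 0, -1, …, -1)` (one bin with load `√n`, `n - √n - 1` bins with load `0`,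
and `√n` bins with load `-1`). Then the potential `Ψ^t = Σ_{i : y_i^t ≥ 0} exp(α y_i^t)`
increases in expectation: `E[Ψ^{t+1} | F^t] ≥ Ψ^t (1 + 0.1 α²/n)`. -/
theorem packing_potential_can_increase (α : ℝ) (hα : 0 < α) :
    ∃ N : ℕ, ∀ n : ℕ, N ≤ n →
      ∀ P : AllocProc n, P.IsPacking → ∀ t : ℕ,
        ∀ᵐ ω ∂P.μ,
          (((Nat.sqrt n : ℝ) = Real.sqrt n) ∧
            (Finset.univ.filter fun i => P.y t ω i = Real.sqrt n).card = 1 ∧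
            (Finset.univ.filter fun i => P.y t ω i = 0).card = n - Nat.sqrt n - 1 ∧
            (Finset.univ.filter fun i => P.y t ω i = -1).card = Nat.sqrt n) →
          P.Ψ α t ω * (1 + 0.1 * α ^ 2 / n) ≤ (P.μ[P.Ψ α (t + 1) | P.F t]) ω := by
  obtain ⟨S, hS⟩ := Filter.eventually_atTop.1 (eventually_growth_bounds hα)
  refine ⟨⌈S⌉₊ ^ 2, fun n hn P hP t => ?_⟩
  obtain ⟨hU, hR⟩ := hP
  have hSn : S ≤ Real.sqrt n := by
    refine (Nat.le_ceil S).trans (Real.le_sqrt_of_sq_le ?_)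
    exact_mod_cast hn
  obtain ⟨hs, h1, h2⟩ := hS _ hSn
  have hns : (n : ℝ) = Real.sqrt n ^ 2 := (Real.sq_sqrt n.cast_nonneg).symm
  set s := Real.sqrt n with hsdef
  have hn2 : 2 ≤ n := by
    have : (2 : ℝ) ≤ n := by nlinarith
    exact_mod_cast this
  set a := Real.exp (α * (s + 1 - 1 / n))
  set b := Real.exp (α * (s - 1 / n))
  set c := Real.exp (α * (s - 2 / n))
  have ha : 0 < a := Real.exp_pos _
  have hb : 0 < b := Real.exp_pos _
  have hc : 0 < c := Real.exp_pos _
  set A : Set P.Ω := {ω | ∃ k, P.y t ω k = s}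
  have hmeas : ∀ (i : Fin n) (r : ℝ), MeasurableSet[P.F t] {ω | P.y t ω i = r} := fun i r =>
    AllocProc.measurable_y t i (measurableSet_singleton r)
  have hA : MeasurableSet[P.F t] A := by
    have : A = ⋃ k, {ω | P.y t ω k = s} := by ext; simp [A]
    rw [this]
    exact MeasurableSet.iUnion fun k => hmeas k s
  set g : Fin n → P.Ω → ℝ := fun i => A.indicator fun ω =>
    if P.y t ω i = s then a else if P.y t ω i = 0 then b else if P.y t ω i = -1 then c else 0
  have hg : ∀ i, Measurable[P.F t] (g i) := fun i =>
    (Measurable.ite (hmeas i s) measurable_const (Measurable.ite (hmeas i 0) measurable_const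
      (Measurable.ite (hmeas i (-1)) measurable_const measurable_const))).indicator hA
  have hbound : ∀ i ω, |g i ω| ≤ a + b + c := fun i ω => by
    simp only [g, Set.indicator_apply]
    split_ifs <;> simp only [abs_of_pos, abs_zero, ha, hb, hc] <;> linarith
  have hle : ∀ ω, g (P.sel t ω) ω ≤ P.Ψ α (t + 1) ω := fun ω => by
    by_cases hω : ω ∈ A
    · obtain ⟨k, hk⟩ := id hω
      simp only [g, Set.indicator_of_mem hω]
      exact hR.le_Ψ_succ α (by linarith) hn2 hk
    · simp only [g, Set.indicator_of_notMem hω]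
      exact AllocProc.Ψ_nonneg _ _ _
  filter_upwards [hU.sum_div_le_condExp t hg hbound (hR.integrable_Ψ hα.le (t + 1)) hle]
    with ω hω ⟨hsq, hc1, hc0, hcm⟩
  have hωA : ω ∈ A := by
    obtain ⟨k, hk⟩ := Finset.card_pos.1 (hc1.symm ▸ Nat.one_pos)
    exact ⟨k, (Finset.mem_filter.1 hk).2⟩
  have hcast : ((n - Nat.sqrt n - 1 : ℕ) : ℝ) = n - s - 1 := by
    have : Nat.sqrt n + 1 ≤ n := by
      have : (Nat.sqrt n : ℝ) + 1 ≤ n := by rw [hsq]; nlinarith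
      exact_mod_cast this
    rw [Nat.sub_sub, Nat.cast_sub this, Nat.cast_add, hsq, Nat.cast_one]
    ring
  have hsums := fun u v w : ℝ => sum_three_values (P.y t ω) (p := s) (q := 0) (r := -1)
    (by linarith) (by linarith) (by norm_num) u v w
  simp only [hc1, hc0, hcm, hcast, hsq, Nat.cast_one, one_mul] at hsums
  have hg_sum : ∑ i, g i ω = a + (n - s - 1) * b + s * c := by
    simp only [g, Set.indicator_of_mem hωA]
    exact hsums a b c
  refine le_trans ?_ (hg_sum ▸ hω)
  have hΨ : P.Ψ α t ω = Real.exp (α * s) + (n - s - 1) := by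
    have hall : ∀ i, P.y t ω i = s ∨ P.y t ω i = 0 ∨ P.y t ω i = -1 := by
      have h111 := hsums 1 1 1
      have hcard : (1 : ℝ) + (n - s - 1) * 1 + s * 1 = ∑ _i : Fin n, (1 : ℝ) := by
        simp
      rw [hcard, Finset.sum_eq_sum_iff_of_le (fun i _ => by split_ifs <;> norm_num)] at h111
      intro i
      by_contra! hi
      simpa [hi] using h111 i (Finset.mem_univ i)
    have h10 := hsums (Real.exp (α * s)) 1 0
    rw [mul_one, mul_zero, add_zero] at h10
    rw [← h10, AllocProc.Ψ]
    refine Finset.sum_congr rfl fun i _ => ?_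
    have hs0 : 0 ≤ s := by linarith
    have hs1 : ¬ (-1 : ℝ) = s := by linarith
    have hs2 : ¬ (0 : ℝ) = s := by linarith
    rcases hall i with hi | hi | hi <;> simp [hi, hs0, hs1, hs2]
  rw [hΨ]
  exact drift_inequality hα hns hs h1 h2
end
end

section
/- For any α > 0, any β ∈ ℝ, any Δ ∈ ℝ, any integer k ≥ 1, and any real numbers x_1, …, x_k satisfying Σ_{j=1}^k x_j ≥ Δ and x_j ≥ β for all 1 ≤ j ≤ k, it holds that Σ_{j=1}^k exp(−α·x_j) ≤ (k − 1)·exp(−α·β) + exp(−α·(Δ − (k − 1)·β)). -/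
/-- Replacing two points `u, y ≥ β` by `β` and `u + y - β`, which have the same sum, does not
decrease the sum of the values of `t ↦ exp (-α t)`. -/
theorem exp_neg_mul_add_le {α β u y : ℝ} (hα : 0 ≤ α) (hu : β ≤ u) (hy : β ≤ y) :
    Real.exp (-(α * u)) + Real.exp (-(α * y))
      ≤ Real.exp (-(α * β)) + Real.exp (-(α * (u + y - β))) := by
  have hp : Real.exp (-(α * (u - β))) ≤ 1 :=
    Real.exp_le_one_iff.2 (neg_nonpos.2 (mul_nonneg hα (sub_nonneg.2 hu)))
  have hq : Real.exp (-(α * (y - β))) ≤ 1 :=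
    Real.exp_le_one_iff.2 (neg_nonpos.2 (mul_nonneg hα (sub_nonneg.2 hy)))
  have h1 : Real.exp (-(α * u)) = Real.exp (-(α * β)) * Real.exp (-(α * (u - β))) := by
    rw [← Real.exp_add]; ring_nf
  have h2 : Real.exp (-(α * y)) = Real.exp (-(α * β)) * Real.exp (-(α * (y - β))) := by
    rw [← Real.exp_add]; ring_nf
  have h3 : Real.exp (-(α * (u + y - β))) =
      Real.exp (-(α * β)) * Real.exp (-(α * (u - β))) * Real.exp (-(α * (y - β))) := by
    rw [← Real.exp_add, ← Real.exp_add]; ring_nf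
  rw [h1, h2, h3]
  linarith [mul_nonneg (Real.exp_nonneg (-(α * β)))
    (mul_nonneg (sub_nonneg.2 hp) (sub_nonneg.2 hq))]

/-- Among families bounded below by `β` with a prescribed sum, `∑ exp (-α x_i)` is largest when
all but one of the entries equal `β`. -/
theorem sum_exp_neg_mul_le {ι : Type*} {α β : ℝ} (hα : 0 ≤ α) (s : Finset ι) (x : ι → ℝ)
    (hx : ∀ i ∈ s, β ≤ x i) :
    ∑ i ∈ s, Real.exp (-(α * x i))
      ≤ ((s.card : ℝ) - 1) * Real.exp (-(α * β)) +
        Real.exp (-(α * (∑ i ∈ s, x i - ((s.card : ℝ) - 1) * β))) := by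
  induction s using Finset.cons_induction with
  | empty => simp
  | cons a s ha ih =>
    have hs : ∀ i ∈ s, β ≤ x i := fun i hi => hx i (Finset.mem_cons_of_mem hi)
    have hcard : (s.card : ℝ) * β ≤ ∑ i ∈ s, x i := by
      simpa [nsmul_eq_mul] using Finset.card_nsmul_le_sum s x β hs
    have hpair := exp_neg_mul_add_le (u := ∑ i ∈ s, x i - ((s.card : ℝ) - 1) * β) hα
      (by linarith) (hx a (Finset.mem_cons_self a s))
    rw [Finset.sum_cons, Finset.sum_cons, Finset.card_cons, Nat.cast_add_one,
      show x a + ∑ i ∈ s, x i - ((s.card : ℝ) + 1 - 1) * β =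
        ∑ i ∈ s, x i - ((s.card : ℝ) - 1) * β + x a - β by ring]
    linarith [ih hs]

/-- **Lemma A.4 (Schur-concavity bound).** For any `α > 0`, `β ∈ ℝ`, `Δ ∈ ℝ`, any integer
`k ≥ 1` and any reals `x_1, …, x_k` with `Σ_j x_j ≥ Δ` and `x_j ≥ β` for all `j`, we have
`Σ_j exp(-α x_j) ≤ (k - 1) exp(-α β) + exp(-α (Δ - (k - 1) β))`. -/
theorem sum_exp_neg_le (α β Δ : ℝ) (hα : 0 < α) (k : ℕ) (hk : 1 ≤ k) (x : ℕ → ℝ)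
    (hsum : Δ ≤ ∑ j ∈ Finset.Icc 1 k, x j)
    (hx : ∀ j, 1 ≤ j → j ≤ k → β ≤ x j) :
    ∑ j ∈ Finset.Icc 1 k, Real.exp (-(α * x j))
      ≤ ((k : ℝ) - 1) * Real.exp (-(α * β)) +
        Real.exp (-(α * (Δ - ((k : ℝ) - 1) * β))) := by
  have h := sum_exp_neg_mul_le hα.le (Finset.Icc 1 k) x fun j hj =>
    hx j (Finset.mem_Icc.1 hj).1 (Finset.mem_Icc.1 hj).2
  rw [Nat.card_Icc, Nat.add_sub_cancel] at h
  refine h.trans ?_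
  gcongr
end
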